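/- Let n ≥ 2, let 1 ≤ i < j ≤ n, and let t ∈ ℝ. The matrix t·e^{(i,j)} ∈ Sym₀(ℝ^n), whose only nonzero entries are t at positions (i,j) and (j,i), admits a feasible decomposition λ with Σ_m λ(m) = |t|; consequently T(t·e^{(i,j)}) = |t|. -/

import Mathlib

/-- The sign `m = (−1)^b` of a bit: encodings `m ∈ {−1,+1}^n` are represented by
boolean vectors `b : Fin n → Bool` via `m i = sgn (b i)`. -/
def sgn (b : Bool) : ℝ := if b then -1 else 1

/-- `lam` is a feasible decomposition of `M ∈ Sym₀(ℝ^n)`: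
`lam ≥ 0` and `M i j = Σ_{m ∈ {−1,+1}^n} lam m * m_i * m_j` for all `i ≠ j`. -/
def IsDecomp {n : ℕ} (M : Matrix (Fin n) (Fin n) ℝ)
    (lam : (Fin n → Bool) → ℝ) : Prop :=
  (∀ m, 0 ≤ lam m) ∧
  ∀ i j : Fin n, i ≠ j →
    M i j = ∑ m : Fin n → Bool, lam m * sgn (m i) * sgn (m j)

/-- The optimal gate time `T(M)`: infimum of `Σ_m lam m` over feasible decompositions. -/
noncomputable def gateTime {n : ℕ} (M : Matrix (Fin n) (Fin n) ℝ) : ℝ :=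
  sInf { t | ∃ lam, IsDecomp M lam ∧ ∑ m : Fin n → Bool, lam m = t }


theorem sgn_not (b : Bool) : sgn (!b) = -sgn b := by
  cases b <;> simp [sgn]

theorem sgn_mul_self (b : Bool) : sgn b * sgn b = 1 := by
  cases b <;> simp [sgn]

theorem abs_sgn (b : Bool) : |sgn b| = 1 := by
  cases b <;> simp [sgn]

/-- Flipping the bit at position `k`. -/
def flipBit {n : ℕ} (k : Fin n) (m : Fin n → Bool) : Fin n → Bool :=
  Function.update m k (!m k)

theorem flipBit_involutive {n : ℕ} (k : Fin n) : Function.Involutive (flipBit k) := by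
  intro m
  simp [flipBit]

theorem sgn_flipBit_self {n : ℕ} (k : Fin n) (m : Fin n → Bool) :
    sgn (flipBit k m k) = -sgn (m k) := by
  simp [flipBit, sgn_not]

theorem flipBit_of_ne {n : ℕ} {k a : Fin n} (h : a ≠ k) (m : Fin n → Bool) :
    flipBit k m a = m a := by
  simp [flipBit, h]

theorem sum_eq_zero_of_flipBit {n : ℕ} (k : Fin n) (f : (Fin n → Bool) → ℝ)
    (h : ∀ m, f (flipBit k m) = -f m) : ∑ m, f m = 0 := by
  have key : ∑ m, f (flipBit k m) = ∑ m, f m :=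
    (flipBit_involutive k).bijective.sum_comp f
  simp only [h, Finset.sum_neg_distrib] at key
  linarith

theorem sum_sgn_mul_sgn {n : ℕ} {a b : Fin n} (h : a ≠ b) :
    ∑ m : Fin n → Bool, sgn (m a) * sgn (m b) = 0 := by
  refine sum_eq_zero_of_flipBit a _ fun m => ?_
  rw [sgn_flipBit_self, flipBit_of_ne h.symm]
  ring

theorem sum_sgn_mul_four {n : ℕ} {i j a b : Fin n} (hij : i ≠ j) :
    ∑ m : Fin n → Bool, sgn (m i) * sgn (m j) * (sgn (m a) * sgn (m b)) =
      if (a = i ∧ b = j) ∨ (a = j ∧ b = i) then 2 ^ n else 0 := by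
  split_ifs with h
  · have h_one : ∀ m : Fin n → Bool,
        sgn (m i) * sgn (m j) * (sgn (m a) * sgn (m b)) = 1 := by
      intro m
      rcases h with ⟨rfl, rfl⟩ | ⟨rfl, rfl⟩
      · linear_combination sgn (m b) * sgn (m b) * sgn_mul_self (m a) + sgn_mul_self (m b)
      · linear_combination sgn (m b) * sgn (m b) * sgn_mul_self (m a) + sgn_mul_self (m b)
    simp [h_one]
  · by_cases hi : a ≠ i ∧ b ≠ i
    · refine sum_eq_zero_of_flipBit i _ fun m => ?_
      rw [sgn_flipBit_self, flipBit_of_ne hij.symm, flipBit_of_ne hi.1, flipBit_of_ne hi.2]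
      ring
    · have hj : a ≠ j ∧ b ≠ j := by grind
      refine sum_eq_zero_of_flipBit j _ fun m => ?_
      rw [sgn_flipBit_self, flipBit_of_ne hij, flipBit_of_ne hj.1, flipBit_of_ne hj.2]
      ring

/-- Every off-diagonal entry bounds the total weight of a decomposition from below. -/
theorem IsDecomp.abs_apply_le_sum {n : ℕ} {M : Matrix (Fin n) (Fin n) ℝ}
    {lam : (Fin n → Bool) → ℝ} (h : IsDecomp M lam) {i j : Fin n} (hij : i ≠ j) :
    |M i j| ≤ ∑ m, lam m := by
  rw [h.2 i j hij]
  refine (Finset.abs_sum_le_sum_abs _ _).trans (Finset.sum_le_sum fun m _ => ?_)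
  simp [abs_mul, abs_sgn, abs_of_nonneg (h.1 m)]

/-- for `n ≥ 2`, `i < j` in `[n]` and `t ∈ ℝ`, the matrix `t·e^{(i,j)}`
(entries `t` at positions `(i,j)` and `(j,i)`, zero elsewhere) admits a feasible
decomposition with total `|t|`; consequently `T(t·e^{(i,j)}) = |t|`. -/
theorem stmt_19 {n : ℕ} (hn : 2 ≤ n) (i j : Fin n) (hij : i < j) (t : ℝ)
    (M : Matrix (Fin n) (Fin n) ℝ)
    (hM : ∀ a b : Fin n, M a b =
      if (a = i ∧ b = j) ∨ (a = j ∧ b = i) then t else 0) :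
    (∃ lam : (Fin n → Bool) → ℝ, IsDecomp M lam ∧
      ∑ m : Fin n → Bool, lam m = |t|) ∧
    gateTime M = |t| := by
  have hne : i ≠ j := hij.ne
  have h_exists : ∃ lam : (Fin n → Bool) → ℝ, IsDecomp M lam ∧
      ∑ m : Fin n → Bool, lam m = |t| := by
    refine ⟨fun m => (|t| + t * (sgn (m i) * sgn (m j))) / 2 ^ n, ⟨fun m => ?_, ?_⟩, ?_⟩
    · have h : |t * (sgn (m i) * sgn (m j))| = |t| := by simp [abs_mul, abs_sgn]
      have := neg_abs_le (t * (sgn (m i) * sgn (m j)))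
      exact div_nonneg (by linarith) (by positivity)
    · intro a b hab
      have h : ∀ m : Fin n → Bool,
          (|t| + t * (sgn (m i) * sgn (m j))) / 2 ^ n * sgn (m a) * sgn (m b) =
            |t| / 2 ^ n * (sgn (m a) * sgn (m b)) +
              t / 2 ^ n * (sgn (m i) * sgn (m j) * (sgn (m a) * sgn (m b))) :=
        fun m => by ring
      simp only [h, Finset.sum_add_distrib, ← Finset.mul_sum, sum_sgn_mul_sgn hab,
        sum_sgn_mul_four hne, hM]
      split_ifs <;> simp
    · rw [← Finset.sum_div, Finset.sum_add_distrib, ← Finset.mul_sum, sum_sgn_mul_sgn hne]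
      simp
  refine ⟨h_exists, IsLeast.csInf_eq ⟨h_exists, ?_⟩⟩
  rintro _ ⟨lam, hlam, rfl⟩
  simpa [hM] using hlam.abs_apply_le_sum hne
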